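/- arXiv:2001.08003 — 4 statements merged into one kernel-verified Lean document; each statement's English description precedes it below -/
import Mathlib

section
/- Let G be an M×M real matrix with nonnegative entries whose columns each sum to 1 (column-stochastic), and let A be the M×M diagonal matrix with diagonal entries α_k satisfying 0 ≤ α_k < 1 for every k. Fix vectors η, m ∈ ℝ^M, and define the affine map F : ℝ^M → ℝ^M by F(t) = (I − A·Gᵀ)⁻¹ · (η + A·Gᵀ·(m + t)), giving the log sector-level marginal costs as a function of the log distortions t. Then for every t ∈ ℝ^M, every pair of indices h ≠ k, the Fréchet derivative of the map t ↦ (F t)_k at t, applied to the h-th standard basis vector e_h, equals the Input Rank υ_{hk} = ((I − G·A)⁻¹)_{hk}. -/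
open Matrix

/-- If `G` is nonnegative and column-stochastic and `0 ≤ α k < 1`, then `1 - diagonal α * Gᵀ` is
strictly diagonally dominant, hence invertible. -/
lemma isUnit_det_one_sub_diagonal_mul_transpose {n : Type*} [Fintype n] [DecidableEq n]
    {G : Matrix n n ℝ} (hG_nonneg : ∀ h k, 0 ≤ G h k) (hG_col : ∀ k, ∑ h, G h k = 1)
    {α : n → ℝ} (hα0 : ∀ k, 0 ≤ α k) (hα1 : ∀ k, α k < 1) :
    IsUnit (1 - Matrix.diagonal α * Gᵀ).det := by
  refine isUnit_iff_ne_zero.mpr (det_ne_zero_of_sum_row_lt_diag fun k => ?_)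
  have hsum : ∑ j ∈ Finset.univ.erase k, ‖(1 - Matrix.diagonal α * Gᵀ) k j‖ =
      α k * ∑ j ∈ Finset.univ.erase k, G j k := by
    rw [Finset.mul_sum]
    refine Finset.sum_congr rfl fun j hj => ?_
    simp [Matrix.one_apply_ne (Finset.ne_of_mem_erase hj).symm, abs_of_nonneg, hα0, hG_nonneg]
  have hcol : G k k + ∑ j ∈ Finset.univ.erase k, G j k = 1 := by
    rw [Finset.add_sum_erase _ (fun j => G j k) (Finset.mem_univ k), hG_col]
  have hdiag : (1 - Matrix.diagonal α * Gᵀ) k k = 1 - α k * G k k := by simp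
  rw [hsum, hdiag, Real.norm_eq_abs]
  refine lt_of_lt_of_le ?_ (le_abs_self _)
  calc α k * ∑ j ∈ Finset.univ.erase k, G j k = α k - α k * G k k := by
        linear_combination α k * hcol
    _ < 1 - α k * G k k := sub_lt_sub_right (hα1 k) _

/-- The derivative of a coordinate of the affine map `t ↦ P *ᵥ (η + B *ᵥ (m + t))` along a standard
basis vector is the corresponding entry of `P * B`. -/
lemma fderiv_mulVec_add_mulVec_single {n : Type*} [Fintype n] [DecidableEq n]
    (P B : Matrix n n ℝ) (η m t : n → ℝ) (h k : n) :
    fderiv ℝ (fun t => (P *ᵥ (η + B *ᵥ (m + t))) k) t (Pi.single h 1) = (P * B) k h := by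
  let L : (n → ℝ) →L[ℝ] ℝ :=
    (ContinuousLinearMap.proj k).comp (LinearMap.toContinuousLinearMap (Matrix.mulVecLin (P * B)))
  have hfun : (fun t => (P *ᵥ (η + B *ᵥ (m + t))) k) =
      fun t => (P *ᵥ (η + B *ᵥ m)) k + L t := by
    funext t
    simp [L, Matrix.mulVec_add, Matrix.mulVec_mulVec, add_assoc]
  rw [hfun, (L.hasFDerivAt.const_add _).fderiv]
  simp [L, Matrix.mul_apply, Matrix.mulVec, dotProduct]

/-- Proposition 1: the elasticity of sector `k`'s (log) marginal cost with
respect to the (log) distortion `τ_h` equals the Input Rank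
`υ_{hk} = ((I − G·A)⁻¹)_{hk}` for `h ≠ k`.  Here the vector of log sector-level
marginal costs as a function of log distortions `t` is
`F t = (I − A·Gᵀ)⁻¹ (η + A·Gᵀ (m + t))`. -/
theorem input_rank_marginal_cost_derivative
    (M : ℕ) (G : Matrix (Fin M) (Fin M) ℝ)
    (hG_nonneg : ∀ h k, 0 ≤ G h k)
    (hG_col : ∀ k, ∑ h, G h k = 1)
    (α : Fin M → ℝ) (hα0 : ∀ k, 0 ≤ α k) (hα1 : ∀ k, α k < 1)
    (η m : Fin M → ℝ)
    (F : (Fin M → ℝ) → (Fin M → ℝ))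
    (hF : ∀ t, F t = (1 - Matrix.diagonal α * Gᵀ)⁻¹ *ᵥ
        (η + (Matrix.diagonal α * Gᵀ) *ᵥ (m + t))) :
    ∀ (t : Fin M → ℝ) (h k : Fin M), h ≠ k →
      fderiv ℝ (fun t => F t k) t (Pi.single h 1) =
        (1 - G * Matrix.diagonal α)⁻¹ h k := by
  intro t h k hhk
  have hdet := isUnit_det_one_sub_diagonal_mul_transpose hG_nonneg hG_col hα0 hα1
  have htranspose : 1 - G * Matrix.diagonal α = (1 - Matrix.diagonal α * Gᵀ)ᵀ := by
    simp [Matrix.transpose_mul]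
  simp only [hF]
  rw [fderiv_mulVec_add_mulVec_single, htranspose, ← Matrix.transpose_nonsing_inv,
    Matrix.transpose_apply]
  have hmul : (1 - Matrix.diagonal α * Gᵀ)⁻¹ * (Matrix.diagonal α * Gᵀ) =
      (1 - Matrix.diagonal α * Gᵀ)⁻¹ - 1 := by
    have hinv := Matrix.nonsing_inv_mul _ hdet
    rw [mul_sub, mul_one] at hinv
    exact eq_sub_of_add_eq (add_comm _ _ |>.trans (sub_eq_iff_eq_add.mp hinv).symm)
  rw [hmul, Matrix.sub_apply, Matrix.one_apply_ne hhk.symm, sub_zero]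
end

section
/- Let n be a natural number with n ≥ 1, let ε > 1 be real, λ > 0, q > 0, and set the markup μ = ε/(ε − 1). Suppose each of n symmetric firms sets price μ·λ and produces output q. Define the sector price P = (n·(μ·λ)^(1−ε))^(1/(1−ε)), the sector output Y = (n·q^((ε−1)/ε))^(ε/(ε−1)), and the sector-level marginal cost Λ = n·λ·q / Y. Then Λ = n^(1/(1−ε))·λ and P = μ·Λ. -/
/-- A CES aggregate of equal components is the component scaled by a power of the weight. -/
theorem Real.mul_rpow_rpow_one_div {a x r : ℝ} (ha : 0 ≤ a) (hx : 0 ≤ x) (hr : r ≠ 0) :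
    (a * x ^ r) ^ (1 / r) = a ^ (1 / r) * x := by
  rw [Real.mul_rpow ha (Real.rpow_nonneg hx r), one_div, Real.rpow_rpow_inv hx hr]

/-- Lemma 2: with `n` symmetric monopolistically competitive firms, each with
marginal cost `λ`, output `q`, and markup `μ = ε/(ε−1)`, the sector-level
marginal cost satisfies `Λ = n^(1/(1−ε))·λ` and the sector price satisfies
`P = μ·Λ`. -/
theorem input_rank_sector_markup
    (n : ℕ) (hn : 1 ≤ n)
    (ε : ℝ) (hε : 1 < ε)
    (lam : ℝ) (hlam : 0 < lam)
    (q : ℝ) (hq : 0 < q)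
    (μ : ℝ) (hμ : μ = ε / (ε - 1))
    (P Y Λ : ℝ)
    (hP : P = ((n : ℝ) * (μ * lam) ^ (1 - ε)) ^ (1 / (1 - ε)))
    (hY : Y = ((n : ℝ) * q ^ ((ε - 1) / ε)) ^ (ε / (ε - 1)))
    (hΛ : Λ = (n : ℝ) * lam * q / Y) :
    Λ = (n : ℝ) ^ (1 / (1 - ε)) * lam ∧ P = μ * Λ := by
  have hn_pos : (0 : ℝ) < n := by exact_mod_cast hn
  have hε_pos : 0 < ε := by linarith
  have hε_sub : 0 < ε - 1 := by linarith
  have hε_sub' : 1 - ε ≠ 0 := by linarith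
  have hμ_pos : 0 < μ := hμ ▸ div_pos hε_pos hε_sub
  have hY_eq : Y = (n : ℝ) ^ (ε / (ε - 1)) * q := by
    rw [hY, ← one_div_div (ε - 1) ε]
    exact Real.mul_rpow_rpow_one_div hn_pos.le hq.le (div_pos hε_sub hε_pos).ne'
  have hP_eq : P = (n : ℝ) ^ (1 / (1 - ε)) * (μ * lam) :=
    hP.trans (Real.mul_rpow_rpow_one_div hn_pos.le (mul_pos hμ_pos hlam).le hε_sub')
  have h_exp : 1 / (1 - ε) = 1 - ε / (ε - 1) := by
    have := hε_sub.ne'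
    rw [← neg_sub ε 1]
    field_simp
    ring
  have hΛ_eq : Λ = (n : ℝ) ^ (1 / (1 - ε)) * lam := by
    rw [hΛ, hY_eq, mul_div_mul_right _ _ hq.ne', h_exp, Real.rpow_sub hn_pos, Real.rpow_one]
    ring
  refine ⟨hΛ_eq, ?_⟩
  rw [hP_eq, hΛ_eq]
  ring
end

section
/- Let n be a natural number with n ≥ 1, let ε > 1, λ > 0, q > 0, p_h > 0 be reals, and let α ≥ 0 and g ≥ 0. Define the sector price p_k = n^(1/(1−ε))·(ε/(ε−1))·λ, the sector output y_k = n^(ε/(ε−1))·q, and the aggregate input demand X = n·(λ·α·g·q/p_h), obtained by summing the conditional demand λ·α·g·q/p_h across the n symmetric firms. Then X = ((ε−1)/ε)·α·g·p_k·y_k / p_h. -/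
/-- Lemma 3: aggregating the conditional demand `λ·α·g·q/p_h` across the `n`
symmetric firms of a sector with price `p_k = n^(1/(1−ε))·(ε/(ε−1))·λ` and output
`y_k = n^(ε/(ε−1))·q` gives the sector-level input demand
`X = ((ε−1)/ε)·α·g·p_k·y_k/p_h`. -/
theorem input_rank_sector_input_demand
    (n : ℕ) (hn : 1 ≤ n)
    (ε : ℝ) (hε : 1 < ε)
    (lam : ℝ) (hlam : 0 < lam)
    (q : ℝ) (hq : 0 < q)
    (ph : ℝ) (hph : 0 < ph)
    (α : ℝ) (hα : 0 ≤ α)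
    (g : ℝ) (hg : 0 ≤ g)
    (pk yk X : ℝ)
    (hpk : pk = (n : ℝ) ^ (1 / (1 - ε)) * (ε / (ε - 1)) * lam)
    (hyk : yk = (n : ℝ) ^ (ε / (ε - 1)) * q)
    (hX : X = (n : ℝ) * (lam * α * g * q / ph)) :
    X = ((ε - 1) / ε) * α * g * pk * yk / ph := by
  have hn_pos : (0 : ℝ) < n := by exact_mod_cast hn
  have hε_ne : ε ≠ 0 := by linarith
  have hε_sub : ε - 1 ≠ 0 := by linarith
  have hexp : 1 / (1 - ε) + ε / (ε - 1) = 1 := by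
    rw [← neg_sub ε 1, div_neg, neg_add_eq_sub, ← sub_div, div_self hε_sub]
  have hpow : (n : ℝ) ^ (1 / (1 - ε)) * (n : ℝ) ^ (ε / (ε - 1)) = n := by
    rw [← Real.rpow_add hn_pos, hexp, Real.rpow_one]
  have hmarkup : (ε - 1) / ε * (ε / (ε - 1)) = 1 := by
    field_simp
  calc
    X = 1 * n * (lam * α * g * q / ph) := by rw [hX, one_mul]
    _ = ((ε - 1) / ε * (ε / (ε - 1))) *
          ((n : ℝ) ^ (1 / (1 - ε)) * (n : ℝ) ^ (ε / (ε - 1))) *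
          (lam * α * g * q / ph) := by rw [hmarkup, hpow]
    _ = ((ε - 1) / ε) * α * g * pk * yk / ph := by
      rw [hpk, hyk]
      generalize (n : ℝ) ^ (1 / (1 - ε)) = a, (n : ℝ) ^ (ε / (ε - 1)) = b,
        ε / (ε - 1) = c, (ε - 1) / ε = d
      ring
end

section
/- Let G be an M×M real matrix with nonnegative entries whose columns each sum to 1 (column-stochastic), let A be the M×M diagonal matrix with diagonal entries α_k satisfying 0 ≤ α_k < 1 for every k, and let μ : Fin M → ℝ satisfy μ_k ≥ 1 for every k. Define the direct-requirements matrix D by D_{hk} = G_{hk}·α_k/μ_k. Then I − D is invertible and for all indices h, k: ((I − D)⁻¹)_{hk} ≤ ((I − G·A)⁻¹)_{hk}; that is, every entry of the Leontief inverse is bounded above by the corresponding entry of the Input Rank matrix. -/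
open Matrix

/-- A row vector `y` with `y (1 - B) ≥ 0` is nonnegative when `B` is nonnegative with
column sums less than one. -/
theorem nonneg_of_vecMul_one_sub_nonneg {n : Type*} [Fintype n] [DecidableEq n]
    {B : Matrix n n ℝ} (hB : ∀ i j, 0 ≤ B i j) (hsum : ∀ j, ∑ i, B i j < 1)
    {y : n → ℝ} (hy : ∀ j, 0 ≤ (y ᵥ* (1 - B)) j) (j : n) : 0 ≤ y j := by
  have : Nonempty n := ⟨j⟩
  obtain ⟨k, hk⟩ := Finite.exists_min y
  refine le_trans ?_ (hk j)
  by_contra! hneg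
  have hyk : ∑ i, y i * B i k ≤ y k := by
    have := hy k
    rw [Matrix.vecMul_sub, Matrix.vecMul_one, Pi.sub_apply, sub_nonneg] at this
    exact this
  have hmin : y k * ∑ i, B i k ≤ ∑ i, y i * B i k := by
    rw [Finset.mul_sum]
    exact Finset.sum_le_sum fun i _ => mul_le_mul_of_nonneg_right (hk i) (hB i k)
  nlinarith [hsum k]

theorem isUnit_one_sub_of_sum_col_lt_one {n : Type*} [Fintype n] [DecidableEq n]
    {B : Matrix n n ℝ} (hB : ∀ i j, 0 ≤ B i j) (hsum : ∀ j, ∑ i, B i j < 1) :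
    IsUnit (1 - B) := by
  rw [← Matrix.vecMul_injective_iff_isUnit]
  intro x y hxy
  have hxy : x ᵥ* (1 - B) = y ᵥ* (1 - B) := hxy
  funext j
  apply le_antisymm
  · have := nonneg_of_vecMul_one_sub_nonneg hB hsum (y := y - x)
      (by simp [Matrix.sub_vecMul, hxy]) j
    simpa using this
  · have := nonneg_of_vecMul_one_sub_nonneg hB hsum (y := x - y)
      (by simp [Matrix.sub_vecMul, hxy]) j
    simpa using this

theorem inv_one_sub_nonneg_of_sum_col_lt_one {n : Type*} [Fintype n] [DecidableEq n]
    {B : Matrix n n ℝ} (hB : ∀ i j, 0 ≤ B i j) (hsum : ∀ j, ∑ i, B i j < 1) (i j : n) :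
    0 ≤ (1 - B)⁻¹ i j := by
  refine nonneg_of_vecMul_one_sub_nonneg hB hsum (y := (1 - B)⁻¹ i) (fun k => ?_) j
  have hdet := (Matrix.isUnit_iff_isUnit_det _).1 (isUnit_one_sub_of_sum_col_lt_one hB hsum)
  rw [← Matrix.mul_apply_eq_vecMul, Matrix.nonsing_inv_mul _ hdet, Matrix.one_apply]
  split_ifs <;> norm_num

/-- The inverse of `1 - B` is entrywise monotone in `B`. -/
theorem inv_one_sub_le_inv_one_sub {n : Type*} [Fintype n] [DecidableEq n]
    {B C : Matrix n n ℝ} (hB : ∀ i j, 0 ≤ B i j) (hBC : ∀ i j, B i j ≤ C i j)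
    (hsum : ∀ j, ∑ i, C i j < 1) (i j : n) :
    (1 - B)⁻¹ i j ≤ (1 - C)⁻¹ i j := by
  have hC : ∀ i j, 0 ≤ C i j := fun i j => (hB i j).trans (hBC i j)
  have hsumB : ∀ j, ∑ i, B i j < 1 := fun j =>
    (Finset.sum_le_sum fun i _ => hBC i j).trans_lt (hsum j)
  have hdetB := (Matrix.isUnit_iff_isUnit_det _).1 (isUnit_one_sub_of_sum_col_lt_one hB hsumB)
  have hdetC := (Matrix.isUnit_iff_isUnit_det _).1 (isUnit_one_sub_of_sum_col_lt_one hC hsum)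
  have key : (1 - C)⁻¹ - (1 - B)⁻¹ = (1 - C)⁻¹ * (C - B) * (1 - B)⁻¹ := by
    have h : C - B = (1 - B) - (1 - C) := by abel
    rw [h, Matrix.mul_sub, Matrix.sub_mul, Matrix.nonsing_inv_mul _ hdetC,
      Matrix.mul_assoc, Matrix.mul_nonsing_inv _ hdetB, Matrix.mul_one, Matrix.one_mul]
  rw [← sub_nonneg, ← Matrix.sub_apply, key, Matrix.mul_apply]
  refine Finset.sum_nonneg fun k _ => mul_nonneg ?_
    (inv_one_sub_nonneg_of_sum_col_lt_one hB hsumB k j)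
  rw [Matrix.mul_apply]
  exact Finset.sum_nonneg fun l _ => mul_nonneg
    (inv_one_sub_nonneg_of_sum_col_lt_one hC hsum i l) (sub_nonneg.2 (hBC l k))

/-- The Input Rank implies more interdependence than the Leontief inverse: with
direct requirements `D_{hk} = g_{hk}·α_k/μ_k` for markups `μ_k ≥ 1`, `I − D` is
invertible and every entry of the Leontief inverse `(I − D)⁻¹` is bounded above
by the corresponding entry of the Input Rank matrix `(I − G·A)⁻¹`. -/
theorem input_rank_dominates_leontief
    (M : ℕ) (G : Matrix (Fin M) (Fin M) ℝ)
    (hG_nonneg : ∀ h k, 0 ≤ G h k)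
    (hG_col : ∀ k, ∑ h, G h k = 1)
    (α : Fin M → ℝ) (hα0 : ∀ k, 0 ≤ α k) (hα1 : ∀ k, α k < 1)
    (μ : Fin M → ℝ) (hμ : ∀ k, 1 ≤ μ k)
    (D : Matrix (Fin M) (Fin M) ℝ)
    (hD : ∀ h k, D h k = G h k * α k / μ k) :
    IsUnit (1 - D) ∧
    ∀ h k, (1 - D)⁻¹ h k ≤ (1 - G * Matrix.diagonal α)⁻¹ h k := by
  have hD0 : ∀ h k, 0 ≤ D h k := fun h k => by
    rw [hD]
    exact div_nonneg (mul_nonneg (hG_nonneg h k) (hα0 k)) (zero_le_one.trans (hμ k))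
  have hDC : ∀ h k, D h k ≤ (G * Matrix.diagonal α) h k := fun h k => by
    rw [hD, Matrix.mul_diagonal]
    exact div_le_self (mul_nonneg (hG_nonneg h k) (hα0 k)) (hμ k)
  have hC : ∀ k, ∑ h, (G * Matrix.diagonal α) h k < 1 := fun k => by
    simp_rw [Matrix.mul_diagonal]
    rw [← Finset.sum_mul, hG_col, one_mul]
    exact hα1 k
  exact ⟨isUnit_one_sub_of_sum_col_lt_one hD0 fun k =>
      (Finset.sum_le_sum fun h _ => hDC h k).trans_lt (hC k),
    inv_one_sub_le_inv_one_sub hD0 hDC hC⟩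
end
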